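/- Let S be a set of colluding users. Suppose every user k ∉ S reports truthfully (d̂_k^t = d_k^t for all t), and every user i ∈ S only over-reports: d̂_i^t ≥ d_i^t for all t. Then for every horizon T, the coalition's total useful allocation under the deviation is at most its total useful allocation under truthful reporting: Σ_{i∈S} Û_i^T ≤ Σ_{i∈S} U_i^T. -/

import Mathlib

open Finset

/-- One step of the Karma algorithm with instantaneous guarantee `α = 0`
(assuming no user runs out of credits): from prior cumulative allocations `R`
and reported demands `d`, each user `k` is allocated
`r k = min (d k) ((lam - R k)⁺)`, where the water level `lam ≥ 0` is such that
`∑ k, r k = min C (∑ k, d k)`. -/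
def KarmaStep (n : ℕ) (C : ℝ) (R d r : Fin n → ℝ) : Prop :=
  ∃ lam : ℝ, 0 ≤ lam ∧ (∀ k, r k = min (d k) (max (lam - R k) 0)) ∧
    (∑ k, r k) = min C (∑ k, d k)

/-- Cumulative allocation of user `k` before quantum `t` (quanta are 0-based):
`cum n r t k = ∑_{τ < t} r τ k`. -/
def cum (n : ℕ) (r : ℕ → Fin n → ℝ) (t : ℕ) (k : Fin n) : ℝ :=
  ∑ τ ∈ Finset.range t, r τ k

/-- A run of the Karma algorithm over quanta `0, 1, 2, …` with reported
demands `d t` and allocations `r t`, starting from zero cumulative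
allocations. -/
def KarmaRun (n : ℕ) (C : ℝ) (d r : ℕ → Fin n → ℝ) : Prop :=
  ∀ t, KarmaStep n C (cum n r t) (d t) (r t)

/-- With a water level no higher than that of the run at cumulative allocation `R`, the useful
allocation at cumulative allocation `Q` grows no faster than the minimum of the two cumulative
allocations. -/
lemma min_add_useful_le {a b R Q d e : ℝ} (hab : b ≤ a) :
    min R Q + min (min e (max (b - Q) 0)) d ≤
      min (R + min d (max (a - R) 0)) (Q + min e (max (b - Q) 0)) := by
  grind

/-- With a water level and a demand at least those of the run at cumulative allocation `R`, the
minimum of the two cumulative allocations grows at least as fast as the allocation at `R`. -/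
lemma min_add_alloc_le {a b R Q d e : ℝ} (hab : a ≤ b) (hde : d ≤ e) :
    min R Q + min d (max (a - R) 0) ≤
      min (R + min d (max (a - R) 0)) (Q + min e (max (b - Q) 0)) := by
  grind

/-- If the reports `e` dominate the demands `d`, one Karma step increases
`∑ k, min (R k) (Q k)` by at least the total useful allocation of the run reporting `e`. -/
lemma KarmaStep.sum_min_add_useful_le {n : ℕ} {C : ℝ} {R Q d e r s : Fin n → ℝ}
    (hde : ∀ k, d k ≤ e k) (hr : KarmaStep n C R d r) (hs : KarmaStep n C Q e s) :
    ∑ k, min (R k) (Q k) + ∑ k, min (s k) (d k) ≤ ∑ k, min (R k + r k) (Q k + s k) := by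
  obtain ⟨a, -, hra, hrsum⟩ := hr
  obtain ⟨b, -, hsb, hssum⟩ := hs
  rcases le_total b a with hab | hab
  · rw [← sum_add_distrib]
    refine sum_le_sum fun k _ => ?_
    rw [hra, hsb]
    exact min_add_useful_le hab
  · have huseful : ∑ k, min (s k) (d k) ≤ ∑ k, r k := by
      rw [hrsum]
      refine le_min ?_ (sum_le_sum fun k _ => min_le_right _ _)
      exact (sum_le_sum fun k _ => min_le_left _ _).trans (hssum.trans_le (min_le_left _ _))
    refine (add_le_add_right huseful _).trans ?_
    rw [← sum_add_distrib]
    refine sum_le_sum fun k _ => ?_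
    rw [hra, hsb]
    exact min_add_alloc_le hab (hde k)

lemma KarmaRun.alloc_le {n : ℕ} {C : ℝ} {d r : ℕ → Fin n → ℝ} (h : KarmaRun n C d r)
    (t : ℕ) (k : Fin n) : r t k ≤ d t k := by
  obtain ⟨a, -, ha, -⟩ := h t
  exact (ha k).trans_le (min_le_left _ _)

/-- If the reports `e` dominate the demands `d`, the total useful allocation of the run reporting
`e` is at most the sum of the coordinatewise minima of the two cumulative allocations. -/
lemma KarmaRun.sum_useful_le_sum_min_cum {n : ℕ} {C : ℝ} {d e r s : ℕ → Fin n → ℝ}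
    (hde : ∀ t k, d t k ≤ e t k) (hr : KarmaRun n C d r) (hs : KarmaRun n C e s) (T : ℕ) :
    ∑ k, ∑ t ∈ range T, min (s t k) (d t k) ≤ ∑ k, min (cum n r T k) (cum n s T k) := by
  induction T with
  | zero => simp [cum]
  | succ T ih =>
    have hstep := (hr T).sum_min_add_useful_le (hde T) (hs T)
    simp only [cum, sum_range_succ, sum_add_distrib] at ih hstep ⊢
    linarith

/-- (Coalitions, over-reporting.) Let `S` be a set of colluding users. If
every user outside `S` reports truthfully and every user in `S` only
over-reports (`d t i ≤ dh t i` for all `t` and `i ∈ S`), then for every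
horizon `T` the coalition's total useful allocation under the deviation is at
most its total useful allocation under truthful reporting. Both runs start
from zero cumulative allocations. -/
theorem karma_coalition_overreporting_never_helps (n : ℕ) (C : ℝ)
    (hC : 0 < C) (S : Finset (Fin n)) (d dh r rh : ℕ → Fin n → ℝ)
    (hd : ∀ t k, 0 ≤ d t k) (hdh : ∀ t k, 0 ≤ dh t k)
    (hsame : ∀ t, ∀ k, k ∉ S → dh t k = d t k)
    (hover : ∀ t, ∀ i ∈ S, d t i ≤ dh t i)
    (hrun : KarmaRun n C d r) (hrunh : KarmaRun n C dh rh) (T : ℕ) :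
    (∑ i ∈ S, ∑ t ∈ Finset.range T, min (rh t i) (d t i)) ≤
      ∑ i ∈ S, ∑ t ∈ Finset.range T, min (r t i) (d t i) := by
  have hde : ∀ t k, d t k ≤ dh t k := fun t k => by
    by_cases hk : k ∈ S
    · exact hover t k hk
    · exact (hsame t k hk).ge
  have hmain := hrun.sum_useful_le_sum_min_cum hde hrunh T
  rw [← sum_add_sum_compl S, ← sum_add_sum_compl S fun k => min (cum n r T k) _] at hmain
  have hout : ∑ k ∈ Sᶜ, min (cum n r T k) (cum n rh T k) ≤
      ∑ k ∈ Sᶜ, ∑ t ∈ range T, min (rh t k) (d t k) := by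
    refine sum_le_sum fun k hk => (min_le_right _ _).trans (sum_le_sum fun t _ => ?_)
    exact le_min le_rfl ((hrunh.alloc_le t k).trans_eq (hsame t k (mem_compl.mp hk)))
  have hin : ∑ k ∈ S, min (cum n r T k) (cum n rh T k) ≤
      ∑ k ∈ S, ∑ t ∈ range T, min (r t k) (d t k) := by
    refine sum_le_sum fun k _ => (min_le_left _ _).trans (sum_le_sum fun t _ => ?_)
    exact le_min le_rfl (hrun.alloc_le t k)
  linarith
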